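/- (The Julia–Zee theorem.) Let V : [0,∞) → [0,∞) be continuously differentiable, and let (A₀, A₁, A₂, φ), with A₀, A₁, A₂ : ℝ² → ℝ twice continuously differentiable and φ : ℝ² → ℂ twice continuously differentiable, be a solution of the static Abelian Higgs equations D₁D₁φ + D₂D₂φ = 2V'(|φ|²)φ − A₀²φ, ∂₂F_{1 2} = (i/2)(φ̄ D₁φ − φ conj(D₁φ)) with the corresponding equation for the second component, and ΔA₀ = |φ|² A₀, whose energy ∫_{ℝ²} [ ½|∇A₀|² + ½ A₀²|φ|² + ½ F_{1 2}² + ½(|D₁φ|² + |D₂φ|²) + V(|φ|²) ] dx is finite. Then either A₀ ≡ 0 (which holds whenever φ is not identically zero) or A₀ is identically constant; in either case the static electric field E^i = −∂_i A₀ vanishes identically and the electric charge density ρ = −A₀|φ|² vanishes identically, i.e. the solution is electrically neutral. -/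

import Mathlib

/-!
The Julia–Zee theorem: a finite-energy solution of the static Abelian Higgs
equations on ℝ² has A₀ ≡ 0 (when φ ≢ 0) or A₀ ≡ constant; in either case the
electric field −∂ᵢA₀ and the charge density −A₀|φ|² vanish identically.
-/

open MeasureTheory

noncomputable section

/-- The plane ℝ². -/
abbrev Plane : Type := EuclideanSpace ℝ (Fin 2)

/-- Partial derivative (real-valued) in the `i`-th coordinate direction. -/
def pd (i : Fin 2) (f : Plane → ℝ) (x : Plane) : ℝ :=
  fderiv ℝ f x (EuclideanSpace.single i 1)

/-- Partial derivative (complex-valued) in the `i`-th coordinate direction. -/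
def pdC (i : Fin 2) (f : Plane → ℂ) (x : Plane) : ℂ :=
  fderiv ℝ f x (EuclideanSpace.single i 1)

/-- The Laplacian on ℝ²: Δf = ∂₁²f + ∂₂²f. -/
def lap (f : Plane → ℝ) (x : Plane) : ℝ :=
  pd 0 (pd 0 f) x + pd 1 (pd 1 f) x

/-- Gauge-covariant derivative D_iφ = ∂_iφ + i A_i φ. -/
def covD (i : Fin 2) (A : Fin 2 → Plane → ℝ) (f : Plane → ℂ) (x : Plane) : ℂ :=
  pdC i f x + Complex.I * (A i x) * f x

open Filter Topology

lemma contDiff_pd {i : Fin 2} {f : Plane → ℝ} {n m : WithTop ℕ∞} (hf : ContDiff ℝ n f)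
    (h : m + 1 ≤ n) : ContDiff ℝ m (pd i f) :=
  (hf.fderiv_right h).clm_apply contDiff_const

/-- A fixed smooth bump function on the plane, equal to `1` on the unit ball and
supported in the ball of radius `2`. -/
def planeBump : ContDiffBump (0 : Plane) := ⟨1, 2, one_pos, one_lt_two⟩

/-- The bump function rescaled by `n + 1`. -/
def cutoff (n : ℕ) (x : Plane) : ℝ := planeBump (((n : ℝ) + 1)⁻¹ • x)

lemma contDiff_cutoff (n : ℕ) : ContDiff ℝ 1 (cutoff n) :=
  planeBump.contDiff.comp (contDiff_const_smul _)

lemma hasCompactSupport_cutoff (n : ℕ) : HasCompactSupport (cutoff n) :=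
  planeBump.hasCompactSupport.comp_smul (by positivity)

lemma cutoff_nonneg (n : ℕ) (x : Plane) : 0 ≤ cutoff n x := planeBump.nonneg

lemma cutoff_le_one (n : ℕ) (x : Plane) : cutoff n x ≤ 1 := planeBump.le_one

lemma cutoff_eq_one {n : ℕ} {x : Plane} (hx : ‖x‖ ≤ n + 1) : cutoff n x = 1 := by
  apply planeBump.one_of_mem_closedBall
  have hn : (0 : ℝ) < n + 1 := by positivity
  rw [mem_closedBall_zero_iff, norm_smul, norm_inv, Real.norm_of_nonneg hn.le]
  change _ ≤ (1 : ℝ)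
  rwa [inv_mul_le_iff₀ hn, mul_one]

lemma cutoff_eq_zero {n : ℕ} {x : Plane} (hx : 2 * ((n : ℝ) + 1) ≤ ‖x‖) : cutoff n x = 0 := by
  apply planeBump.zero_of_le_dist
  have hn : (0 : ℝ) < n + 1 := by positivity
  rw [dist_zero_right, norm_smul, norm_inv, Real.norm_of_nonneg hn.le]
  change (2 : ℝ) ≤ _
  rw [le_inv_mul_iff₀ hn]
  linarith

lemma pd_cutoff (n : ℕ) (i : Fin 2) (x : Plane) :
    pd i (cutoff n) x = ((n : ℝ) + 1)⁻¹ * pd i planeBump (((n : ℝ) + 1)⁻¹ • x) := by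
  unfold pd cutoff
  rw [fderiv_comp_smul]
  simp

lemma pd_cutoff_eq_zero {n : ℕ} {i : Fin 2} {x : Plane} (hx : ‖x‖ < n + 1) :
    pd i (cutoff n) x = 0 := by
  have h : cutoff n =ᶠ[𝓝 x] fun _ => 1 := by
    filter_upwards [continuous_norm.continuousAt.eventually_lt continuousAt_const hx] with y hy
    exact cutoff_eq_one hy.le
  simp [pd, h.fderiv_eq]

/-- In two dimensions the Dirichlet energy of the cutoffs does not depend on the scale. -/
lemma integral_pd_cutoff_sq (n : ℕ) (i : Fin 2) :
    ∫ x, pd i (cutoff n) x ^ 2 = ∫ x, pd i planeBump x ^ 2 := by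
  have hn : (0 : ℝ) < n + 1 := by positivity
  simp_rw [pd_cutoff, mul_pow]
  rw [integral_const_mul,
    Measure.integral_comp_smul volume (fun x => pd i planeBump x ^ 2) ((n : ℝ) + 1)⁻¹]
  simp only [finrank_euclideanSpace, Fintype.card_fin, smul_eq_mul]
  rw [abs_of_pos (by positivity)]
  field_simp

lemma tendsto_tail_integral {f : Plane → ℝ} (hf : Integrable f) :
    Tendsto (fun n : ℕ => ∫ x in {x : Plane | (n : ℝ) + 1 ≤ ‖x‖}, f x) atTop (𝓝 0) := by
  have h := tendsto_setIntegral_of_antitone (μ := volume) (f := f)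
    (s := fun n : ℕ => {x : Plane | (n : ℝ) + 1 ≤ ‖x‖})
    (fun n => measurableSet_le measurable_const measurable_norm)
    (fun m n hmn x (hx : (n : ℝ) + 1 ≤ ‖x‖) => by
      have : (m : ℝ) ≤ n := by exact_mod_cast hmn
      change (m : ℝ) + 1 ≤ ‖x‖
      linarith)
    ⟨0, hf.integrableOn⟩
  have he : (⋂ n : ℕ, {x : Plane | (n : ℝ) + 1 ≤ ‖x‖}) = ∅ := by
    ext x
    obtain ⟨n, hn⟩ := exists_nat_gt ‖x‖
    simp only [Set.mem_iInter, Set.mem_ofPred_eq, Set.mem_empty_iff_false, iff_false, not_forall,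
      not_le]
    exact ⟨n, by linarith⟩
  simpa [he] using h

lemma integral_cutoff_mul_pd {w : Plane → ℝ} (hw : ContDiff ℝ 1 w) (n : ℕ) (i : Fin 2) :
    ∫ x, cutoff n x * pd i w x = -∫ x, pd i (cutoff n) x * w x := by
  have hη := contDiff_cutoff n
  have hcs := hasCompactSupport_cutoff n
  have hcη : Continuous (pd i (cutoff n)) := (contDiff_pd (m := 0) hη (by simp)).continuous
  have hcw : Continuous (pd i w) := (contDiff_pd (m := 0) hw (by simp)).continuous
  refine integral_mul_fderiv_eq_neg_fderiv_mul_of_integrable ?_ ?_ ?_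
    (fun x _ => hη.differentiable one_ne_zero x) (fun x _ => hw.differentiable one_ne_zero x)
  · exact (hcη.mul hw.continuous).integrable_of_hasCompactSupport
      (hcs.fderiv_apply ℝ _).mul_right
  · exact (hη.continuous.mul hcw).integrable_of_hasCompactSupport hcs.mul_right
  · exact (hη.continuous.mul hw.continuous).integrable_of_hasCompactSupport hcs.mul_right

lemma abs_integral_cutoff_mul_pd_le {w : Plane → ℝ} (hw : ContDiff ℝ 1 w)
    (hint : Integrable fun x => w x ^ 2) (n : ℕ) (i : Fin 2) {δ : ℝ} (hδ : 0 < δ) :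
    |∫ x, cutoff n x * pd i w x| ≤ δ * (∫ x, pd i planeBump x ^ 2)
      + δ⁻¹ * ∫ x in {x : Plane | (n : ℝ) + 1 ≤ ‖x‖}, w x ^ 2 := by
  have hS : MeasurableSet {x : Plane | (n : ℝ) + 1 ≤ ‖x‖} :=
    measurableSet_le measurable_const measurable_norm
  have hcη : Continuous (pd i (cutoff n)) :=
    (contDiff_pd (m := 0) (contDiff_cutoff n) (by simp)).continuous
  have hsupp : HasCompactSupport (pd i (cutoff n)) :=
    (hasCompactSupport_cutoff n).fderiv_apply ℝ _
  have hint₁ : Integrable fun x => δ * pd i (cutoff n) x ^ 2 := by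
    simp_rw [pow_two]
    exact ((hcη.mul hcη).integrable_of_hasCompactSupport hsupp.mul_right).const_mul _
  have hint₂ : Integrable fun x =>
      δ⁻¹ * {x : Plane | (n : ℝ) + 1 ≤ ‖x‖}.indicator (fun x => w x ^ 2) x :=
    (hint.indicator hS).const_mul _
  rw [integral_cutoff_mul_pd hw, abs_neg, ← integral_pd_cutoff_sq n, ← integral_indicator hS,
    ← integral_const_mul, ← integral_const_mul, ← integral_add hint₁ hint₂]
  refine (abs_integral_le_integral_abs).trans (integral_mono ?_ (hint₁.add hint₂) fun x => ?_)
  · exact ((hcη.mul hw.continuous).integrable_of_hasCompactSupport hsupp.mul_right).abs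
  · by_cases hx : (n : ℝ) + 1 ≤ ‖x‖
    · rw [Set.indicator_of_mem (by exact hx), abs_mul, ← sq_abs (pd i (cutoff n) x),
        ← sq_abs (w x)]
      have h1 : δ * δ⁻¹ = 1 := mul_inv_cancel₀ hδ.ne'
      have h2 := mul_nonneg (inv_nonneg.2 hδ.le)
        (sq_nonneg (δ * |pd i (cutoff n) x| - |w x|))
      have h3 : δ⁻¹ * (δ * |pd i (cutoff n) x| - |w x|) ^ 2 = δ * |pd i (cutoff n) x| ^ 2
          - 2 * (|pd i (cutoff n) x| * |w x|) + δ⁻¹ * |w x| ^ 2 := by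
        field_simp
        ring
      have h4 : 0 ≤ |pd i (cutoff n) x| * |w x| := by positivity
      linarith
    · rw [pd_cutoff_eq_zero (not_le.1 hx), Set.indicator_of_notMem (by exact hx)]
      simp

lemma tendsto_integral_cutoff_mul_pd {w : Plane → ℝ} (hw : ContDiff ℝ 1 w)
    (hint : Integrable fun x => w x ^ 2) (i : Fin 2) :
    Tendsto (fun n => ∫ x, cutoff n x * pd i w x) atTop (𝓝 0) := by
  set K := ∫ x, pd i planeBump x ^ 2
  have hK0 : 0 ≤ K := integral_nonneg fun x => sq_nonneg _
  rw [Metric.tendsto_nhds]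
  intro ε hε
  set δ := ε / (2 * (K + 1)) with hδ'
  have hδ : 0 < δ := by positivity
  filter_upwards [(tendsto_tail_integral hint).eventually_lt_const (sq_pos_of_pos hδ)] with n hn
  rw [dist_zero_right, Real.norm_eq_abs]
  refine (abs_integral_cutoff_mul_pd_le hw hint n i hδ).trans_lt ?_
  have h1 : δ⁻¹ * ∫ x in {x : Plane | (n : ℝ) + 1 ≤ ‖x‖}, w x ^ 2 < δ := by
    rw [inv_mul_lt_iff₀ hδ]
    linarith
  have h2 : δ * (K + 1) = ε / 2 := by
    rw [hδ']
    field_simp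
  linarith

/-- A square-integrable `C¹` vector field on the plane with nonnegative divergence is
divergence free. -/
lemma divergence_eq_zero_of_nonneg {w : Fin 2 → Plane → ℝ} (hw : ∀ i, ContDiff ℝ 1 (w i))
    (hint : ∀ i, Integrable fun x => w i x ^ 2)
    (hdiv : ∀ x, 0 ≤ pd 0 (w 0) x + pd 1 (w 1) x) (x : Plane) :
    pd 0 (w 0) x + pd 1 (w 1) x = 0 := by
  have hc : ∀ i, Continuous (pd i (w i)) := fun i =>
    (contDiff_pd (m := 0) (hw i) (by simp)).continuous
  have hmul : ∀ n i, Integrable fun y => cutoff n y * pd i (w i) y := fun n i =>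
    ((contDiff_cutoff n).continuous.mul (hc i)).integrable_of_hasCompactSupport
      (hasCompactSupport_cutoff n).mul_right
  have hI : ∀ n, Integrable fun y => cutoff n y * (pd 0 (w 0) y + pd 1 (w 1) y) := fun n => by
    simp only [mul_add]
    exact (hmul n 0).add (hmul n 1)
  have hlim : Tendsto (fun n => ∫ y, cutoff n y * (pd 0 (w 0) y + pd 1 (w 1) y)) atTop (𝓝 0) := by
    have h := (tendsto_integral_cutoff_mul_pd (hw 0) (hint 0) 0).add
      (tendsto_integral_cutoff_mul_pd (hw 1) (hint 1) 1)
    rw [add_zero] at h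
    refine h.congr fun n => ?_
    rw [← integral_add (hmul n 0) (hmul n 1)]
    simp only [mul_add]
  by_contra hx
  obtain ⟨m, hm⟩ := exists_nat_ge ‖x‖
  have hpos : 0 < ∫ y, cutoff m y * (pd 0 (w 0) y + pd 1 (w 1) y) := by
    refine Continuous.integral_pos_of_hasCompactSupport_nonneg_nonzero (x := x)
      ((contDiff_cutoff m).continuous.mul ((hc 0).add (hc 1)))
      (hasCompactSupport_cutoff m).mul_right
      (fun y => mul_nonneg (cutoff_nonneg m y) (hdiv y)) ?_
    rw [cutoff_eq_one (by linarith), one_mul]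
    exact hx
  refine hpos.not_ge (ge_of_tendsto hlim ?_)
  filter_upwards [eventually_ge_atTop (2 * (m + 1))] with n hn
  refine integral_mono (hI m) (hI n) fun y => mul_le_mul_of_nonneg_right ?_ (hdiv y)
  rcases le_total ‖y‖ (2 * ((m : ℝ) + 1)) with hy | hy
  · have : 2 * ((m : ℝ) + 1) ≤ n := by exact_mod_cast hn
    rw [cutoff_eq_one (n := n) (by linarith)]
    exact cutoff_le_one m y
  · rw [cutoff_eq_zero hy]
    exact cutoff_nonneg n y

lemma pd_arctan_mul_pd {A : Plane → ℝ} (hA : ContDiff ℝ 2 A) (i : Fin 2) (x : Plane) :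
    pd i (fun y => Real.arctan (A y) * pd i A y) x
      = pd i A x ^ 2 / (1 + A x ^ 2) + Real.arctan (A x) * pd i (pd i A) x := by
  have h1 : HasFDerivAt A (fderiv ℝ A x) x := (hA.differentiable two_ne_zero x).hasFDerivAt
  have h2 : HasFDerivAt (pd i A) (fderiv ℝ (pd i A) x) x :=
    ((contDiff_pd (m := 1) hA (by norm_num [one_add_one_eq_two])).differentiable
      one_ne_zero x).hasFDerivAt
  rw [pd, (h1.arctan.fun_mul h2).fderiv]
  simp only [pd, add_apply, smul_apply, smul_eq_mul, one_div]
  ring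

lemma mul_arctan_nonneg (a : ℝ) : 0 ≤ a * Real.arctan a := by
  rcases le_total 0 a with h | h
  · exact mul_nonneg h (Real.arctan_nonneg.2 h)
  · exact mul_nonneg_of_nonpos_of_nonpos h (Real.arctan_le_zero.2 h)

/-- A function with square-integrable gradient satisfying `ΔA = qA` with `q ≥ 0` has
vanishing partial derivatives. -/
lemma pd_eq_zero_of_lap_eq {A q : Plane → ℝ} (hA : ContDiff ℝ 2 A)
    (hint : ∀ i, Integrable fun x => pd i A x ^ 2) (hq : ∀ x, 0 ≤ q x)
    (h : ∀ x, lap A x = q x * A x) (i : Fin 2) (x : Plane) : pd i A x = 0 := by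
  have hpd : ∀ i, ContDiff ℝ 1 (pd i A) := fun i =>
    contDiff_pd hA (by norm_num [one_add_one_eq_two])
  have hw : ∀ i, ContDiff ℝ 1 fun y => Real.arctan (A y) * pd i A y := fun i =>
    (Real.contDiff_arctan.comp (hA.of_le one_le_two)).mul (hpd i)
  have hdiv : ∀ x, pd 0 (fun y => Real.arctan (A y) * pd 0 A y) x
      + pd 1 (fun y => Real.arctan (A y) * pd 1 A y) x
      = pd 0 A x ^ 2 / (1 + A x ^ 2) + pd 1 A x ^ 2 / (1 + A x ^ 2)
        + q x * (A x * Real.arctan (A x)) := fun x => by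
    have h' := h x
    rw [lap] at h'
    rw [pd_arctan_mul_pd hA, pd_arctan_mul_pd hA]
    linear_combination Real.arctan (A x) * h'
  have h0 := divergence_eq_zero_of_nonneg (w := fun i y => Real.arctan (A y) * pd i A y) hw
    (fun i => by
      refine ((hint i).const_mul ((Real.pi / 2) ^ 2)).mono'
        ((hw i).continuous.pow 2).aestronglyMeasurable (ae_of_all _ fun y => ?_)
      rw [Real.norm_of_nonneg (sq_nonneg _), mul_pow]
      exact mul_le_mul_of_nonneg_right (sq_le_sq' (Real.neg_pi_div_two_lt_arctan _).le
        (Real.arctan_lt_pi_div_two _).le) (sq_nonneg _))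
    (fun y => by
      rw [hdiv]
      have := mul_nonneg (hq y) (mul_arctan_nonneg (A y))
      positivity) x
  rw [hdiv] at h0
  have hpos : 0 < 1 + A x ^ 2 := by positivity
  have ha := mul_nonneg (hq x) (mul_arctan_nonneg (A x))
  have hi : ∀ j, 0 ≤ pd j A x ^ 2 / (1 + A x ^ 2) := fun j => by positivity
  have hzero : pd i A x ^ 2 / (1 + A x ^ 2) = 0 := by
    have h0' := hi 0
    have h1' := hi 1
    fin_cases i
    · change pd 0 A x ^ 2 / (1 + A x ^ 2) = 0
      linarith
    · change pd 1 A x ^ 2 / (1 + A x ^ 2) = 0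
      linarith
  rcases div_eq_zero_iff.1 hzero with h | h
  · exact pow_eq_zero_iff two_ne_zero |>.1 h
  · exact absurd h hpos.ne'

lemma pd_sq_le_norm_gradient_sq (A : Plane → ℝ) (i : Fin 2) (x : Plane) :
    pd i A x ^ 2 ≤ ‖gradient A x‖ ^ 2 := by
  rw [pd, ← inner_gradient_left]
  refine sq_le_sq.2 ((abs_real_inner_le_norm _ _).trans ?_)
  simp

lemma fderiv_eq_zero_of_pd_eq_zero {A : Plane → ℝ} {x : Plane} (h : ∀ i, pd i A x = 0) :
    fderiv ℝ A x = 0 :=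
  ContinuousLinearMap.coe_injective <|
    (EuclideanSpace.basisFun (Fin 2) ℝ).toBasis.ext fun i => by simpa [pd] using h i

theorem julia_zee
    (V : ℝ → ℝ) (hV : ContDiff ℝ 1 V) (hVnonneg : ∀ s, 0 ≤ s → 0 ≤ V s)
    (A₀ A₁ A₂ : Plane → ℝ) (φ : Plane → ℂ)
    (hA₀ : ContDiff ℝ 2 A₀) (hA₁ : ContDiff ℝ 2 A₁) (hA₂ : ContDiff ℝ 2 A₂)
    (hφ : ContDiff ℝ 2 φ)
    -- the Higgs equation D₁D₁φ + D₂D₂φ = 2V'(|φ|²)φ − A₀²φ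
    (hHiggs : ∀ x, covD 0 ![A₁, A₂] (covD 0 ![A₁, A₂] φ) x
        + covD 1 ![A₁, A₂] (covD 1 ![A₁, A₂] φ) x
        = (2 * deriv V (‖φ x‖ ^ 2) : ℝ) * φ x - ((A₀ x) ^ 2 : ℝ) * φ x)
    -- the Maxwell equation, j = 1 component: ∂₂F₁₂ = (i/2)(φ̄ D₁φ − φ conj(D₁φ))
    (hMax1 : ∀ x, ((pd 1 (fun y => pd 0 A₂ y - pd 1 A₁ y) x : ℝ) : ℂ)
        = Complex.I / 2 * ((starRingEnd ℂ) (φ x) * covD 0 ![A₁, A₂] φ x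
            - φ x * (starRingEnd ℂ) (covD 0 ![A₁, A₂] φ x)))
    -- the Maxwell equation, j = 2 component: ∂₁F₂₁ = (i/2)(φ̄ D₂φ − φ conj(D₂φ))
    (hMax2 : ∀ x, ((-(pd 0 (fun y => pd 0 A₂ y - pd 1 A₁ y) x) : ℝ) : ℂ)
        = Complex.I / 2 * ((starRingEnd ℂ) (φ x) * covD 1 ![A₁, A₂] φ x
            - φ x * (starRingEnd ℂ) (covD 1 ![A₁, A₂] φ x)))
    -- the Gauss law ΔA₀ = |φ|² A₀
    (hGauss : ∀ x, lap A₀ x = ‖φ x‖ ^ 2 * A₀ x)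
    -- finite energy
    (hfin : Integrable (fun x =>
        (1 / 2) * ‖gradient A₀ x‖ ^ 2 + (1 / 2) * (A₀ x) ^ 2 * ‖φ x‖ ^ 2
        + (1 / 2) * (pd 0 A₂ x - pd 1 A₁ x) ^ 2
        + (1 / 2) * (‖covD 0 ![A₁, A₂] φ x‖ ^ 2 + ‖covD 1 ![A₁, A₂] φ x‖ ^ 2)
        + V (‖φ x‖ ^ 2))) :
    ((∃ x, φ x ≠ 0) → ∀ x, A₀ x = 0) ∧
    (∃ c : ℝ, ∀ x, A₀ x = c) ∧
    (∀ i x, -(pd i A₀ x) = 0) ∧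
    (∀ x, -(A₀ x) * ‖φ x‖ ^ 2 = 0) := by
  have hint : ∀ i, Integrable fun x => pd i A₀ x ^ 2 := fun i => by
    refine (hfin.const_mul 2).mono'
      ((contDiff_pd (m := 0) (hA₀.of_le one_le_two) (by simp)).continuous.pow
        2).aestronglyMeasurable (ae_of_all _ fun x => ?_)
    rw [Real.norm_of_nonneg (sq_nonneg _)]
    have h1 := pd_sq_le_norm_gradient_sq A₀ i x
    have h2 := hVnonneg (‖φ x‖ ^ 2) (sq_nonneg _)
    have h3 : 0 ≤ A₀ x ^ 2 * ‖φ x‖ ^ 2 := by positivity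
    have h4 := sq_nonneg (pd 0 A₂ x - pd 1 A₁ x)
    have h5 := sq_nonneg ‖covD 0 ![A₁, A₂] φ x‖
    have h6 := sq_nonneg ‖covD 1 ![A₁, A₂] φ x‖
    linarith
  have hpd : ∀ i x, pd i A₀ x = 0 :=
    pd_eq_zero_of_lap_eq hA₀ hint (fun x => sq_nonneg ‖φ x‖) hGauss
  have hconst : ∀ x y, A₀ x = A₀ y :=
    is_const_of_fderiv_eq_zero (hA₀.differentiable two_ne_zero) fun x =>
      fderiv_eq_zero_of_pd_eq_zero fun i => hpd i x
  have hcharge : ∀ x, ‖φ x‖ ^ 2 * A₀ x = 0 := fun x => by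
    have hpd' : ∀ i, pd i A₀ = fun _ => 0 := fun i => funext (hpd i)
    rw [← hGauss x, lap, hpd', hpd']
    simp [pd]
  refine ⟨fun ⟨y, hy⟩ x => ?_, ⟨A₀ 0, fun x => hconst x 0⟩, fun i x => by simp [hpd], fun x => ?_⟩
  · rw [hconst x y]
    exact (mul_eq_zero.1 (hcharge y)).resolve_left (by simpa using hy)
  · linarith [hcharge x]

end
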